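/- Let S = ((x₁,y₁),…,(x_n,y_n)) with xᵢ ∈ ℝ^d and yᵢ ∈ {1,…,k}, and let ‖X‖_F = (Σ_{i=1}^{n} ‖xᵢ‖₂²)^{1/2}. Consider the class H of convolutional neural networks h_C described below with weight bounds (aᵢ), (sᵢ) and complexity R_C, and let η > 0. Let H_η = { (x,y) ↦ ℓ_η(h_C(x), y) : h_C ∈ H } be the ramp-loss class. Then the empirical Rademacher complexity of H_η on the sample S satisfies R_S(H_η) ≤ 16·n^{−5/8}·(2‖X‖_F·R_C/η)^{1/4}. -/

import Mathlib

noncomputable def frobNorm {α β : Type*} [Fintype α] [Fintype β] (M : Matrix α β ℝ) : ℝ :=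
  Real.sqrt (∑ i, ∑ j, (M i j) ^ 2)

noncomputable def specNorm {α β : Type*} [Fintype α] [Fintype β] [DecidableEq β]
    (M : Matrix α β ℝ) : ℝ :=
  ‖LinearMap.toContinuousLinearMap (Matrix.toEuclideanLin M)‖

/-- The fully connected matrix `γ(W)` built from a convolutional weight `W ∈ ℝ^{c×r}` via
`m` index maps `S k : Fin r → Fin d`. -/
noncomputable def gamma {c r d m : ℕ} (S : Fin m → Fin r → Fin d)
    (W : Matrix (Fin c) (Fin r) ℝ) : Matrix (Fin c × Fin m) (Fin d) ℝ :=
  fun ik j => ∑ p, if S ik.2 p = j then W ik.1 p else 0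

/-- The network `h_C(x)` evaluated layer by layer on a vector input. -/
noncomputable def netVec (d : ℕ → ℕ)
    (C : ∀ i : ℕ, Matrix (Fin (d (i+1))) (Fin (d i)) ℝ)
    (σ : ∀ i : ℕ, (Fin (d (i+1)) → ℝ) → (Fin (d (i+1)) → ℝ))
    (x : Fin (d 0) → ℝ) : (ℓ : ℕ) → (Fin (d ℓ) → ℝ)
  | 0 => x
  | (ℓ+1) => σ ℓ ((C ℓ).mulVec (netVec d C σ x ℓ))

/-- `g_η(r) = 0` for `r < −η`, `1 + r/η` for `−η ≤ r ≤ 0`, `1` for `r > 0`. -/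
noncomputable def rampFn (η r : ℝ) : ℝ := if r < -η then 0 else if r ≤ 0 then 1 + r / η else 1

/-- Ramp loss `ℓ_η(v,y) = g_η(−(v_y − max_{j≠y} v_j))`. -/
noncomputable def rampLoss {k : ℕ} (η : ℝ) (v : Fin k → ℝ) (y : Fin k) : ℝ :=
  rampFn η (-(v y - sSup (v '' {j | j ≠ y})))


open MeasureTheory Metric Module in
theorem aux_card_sep {E : Type*} [NormedAddCommGroup E] [NormedSpace ℝ E] [FiniteDimensional ℝ E]
    (s : Finset E) (a δ : ℝ) (ha : 0 ≤ a) (hδ : 0 < δ) (hs : ∀ c ∈ s, ‖c‖ ≤ a)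
    (h : ∀ c ∈ s, ∀ d ∈ s, c ≠ d → δ ≤ ‖c - d‖) :
    (s.card : ℝ) ≤ (1 + 2 * a / δ) ^ finrank ℝ E := by
  borelize E
  let μ : Measure E := Measure.addHaar
  have hδ2 : 0 < δ / 2 := by positivity
  have ρpos : 0 < a + δ / 2 := by positivity
  set A := ⋃ c ∈ s, ball (c : E) (δ / 2) with hA
  have D : Set.Pairwise (s : Set E) (Function.onFun Disjoint fun c => ball (c : E) (δ / 2)) := by
    rintro c hc d hd hcd
    apply ball_disjoint_ball
    rw [dist_eq_norm]
    have := h c hc d hd hcd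
    linarith
  have A_subset : A ⊆ ball (0 : E) (a + δ / 2) := by
    refine Set.iUnion₂_subset fun x hx => ?_
    apply ball_subset_ball'
    rw [dist_zero_right]
    have := hs x hx
    linarith
  have I : (s.card : ENNReal) * ENNReal.ofReal ((δ / 2) ^ finrank ℝ E) * μ (ball 0 1) ≤
      ENNReal.ofReal ((a + δ / 2) ^ finrank ℝ E) * μ (ball 0 1) :=
    calc
      (s.card : ENNReal) * ENNReal.ofReal ((δ / 2) ^ finrank ℝ E) * μ (ball 0 1) = μ A := by
        rw [hA, measure_biUnion_finset D fun c _ => measurableSet_ball]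
        simp only [μ.addHaar_ball_of_pos _ hδ2]
        simp only [Finset.sum_const, nsmul_eq_mul, mul_assoc]
      _ ≤ μ (ball (0 : E) (a + δ / 2)) := measure_mono A_subset
      _ = ENNReal.ofReal ((a + δ / 2) ^ finrank ℝ E) * μ (ball 0 1) := by
        simp only [μ.addHaar_ball_of_pos _ ρpos]
  have J : (s.card : ENNReal) * ENNReal.ofReal ((δ / 2) ^ finrank ℝ E)
      ≤ ENNReal.ofReal ((a + δ / 2) ^ finrank ℝ E) :=
    (ENNReal.mul_le_mul_iff_left (measure_ball_pos _ _ zero_lt_one).ne' measure_ball_lt_top.ne).1 I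
  have K := ENNReal.toReal_le_of_le_ofReal (pow_nonneg ρpos.le _) J
  rw [ENNReal.toReal_mul, ENNReal.toReal_natCast, ENNReal.toReal_ofReal (by positivity)] at K
  have e : (1 + 2 * a / δ) = (a + δ / 2) / (δ / 2) := by field_simp; ring
  rw [e, div_pow, le_div_iff₀ (by positivity)]
  exact K

open Module in
theorem aux_cover {E : Type*} [NormedAddCommGroup E] [NormedSpace ℝ E] [FiniteDimensional ℝ E]
    (K : Set E) (hK : K.Nonempty) (a δ κ : ℝ) (ha : 0 ≤ a) (hδ : 0 < δ) (hκ : 0 ≤ κ)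
    (hs : ∀ c ∈ K, ‖c‖ ≤ a) :
    ∃ U : Finset E, U.Nonempty ∧ (∀ u ∈ U, u ∈ K) ∧
      (U.card : ℝ) ≤ (1 + 2 * (a * κ) / δ) ^ finrank ℝ E ∧
      ∀ w ∈ K, ∃ u ∈ U, κ * ‖w - u‖ ≤ δ := by
  classical
  obtain ⟨w0, hw0⟩ := hK
  rcases hκ.eq_or_lt with h0 | hκ
  · refine ⟨{w0}, by simp, by simpa using hw0, by simp [← h0], ?_⟩
    intro w _
    exact ⟨w0, by simp, by rw [← h0]; simpa using hδ.le⟩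
  set δ' := δ / κ with hδ'
  have hδ'0 : 0 < δ' := by positivity
  let P : Set ℕ := {k | ∃ s : Finset E, (∀ u ∈ s, u ∈ K) ∧
    (∀ c ∈ s, ∀ d ∈ s, c ≠ d → δ' ≤ ‖c - d‖) ∧ s.card = k}
  have hbd : ∀ k ∈ P, (k : ℝ) ≤ (1 + 2 * a / δ') ^ finrank ℝ E := by
    rintro k ⟨s, h1, h2, rfl⟩
    exact aux_card_sep s a δ' ha hδ'0 (fun c hc => hs c (h1 c hc)) h2
  have hne : P.Nonempty := ⟨1, {w0}, by simpa using hw0, by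
    intro c hc d hd; simp at hc hd; simp [hc, hd], by simp⟩
  have hba : BddAbove P := ⟨⌈(1 + 2 * a / δ') ^ finrank ℝ E⌉₊, fun k hk => by
    have := (hbd k hk).trans (Nat.le_ceil _)
    exact_mod_cast this⟩
  have hmem := Nat.sSup_mem hne hba
  have hmem' := hmem
  obtain ⟨s, h1, h2, h3⟩ := hmem
  have h1le : 1 ≤ sSup P := le_csSup hba ⟨{w0}, by simpa using hw0, by
    intro c hc d hd; simp at hc hd; simp [hc, hd], by simp⟩
  refine ⟨s, Finset.card_pos.1 (by omega), h1, ?_, ?_⟩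
  · have := hbd _ hmem'
    rw [h3]
    have e : 2 * (a * κ) / δ = 2 * a / δ' := by rw [hδ']; field_simp
    rw [e]; exact this
  · intro w hw
    by_contra! hcon
    have hlt : ∀ u ∈ s, δ' < ‖w - u‖ := fun u hu => by
      rw [hδ', div_lt_iff₀ hκ, mul_comm]; exact hcon u hu
    have hws : w ∉ s := fun h => by
      have := hlt w h
      simp at this; linarith
    have : s.card + 1 ∈ P := ⟨insert w s, by
        intro u hu
        rcases Finset.mem_insert.1 hu with rfl | hu
        · exact hw
        · exact h1 u hu, by
        intro c hc d hd hcd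
        rcases Finset.mem_insert.1 hc with hc | hc <;> rcases Finset.mem_insert.1 hd with hd | hd
        · exact absurd (hc.trans hd.symm) hcd
        · rw [hc]; exact (hlt d hd).le
        · rw [hd, norm_sub_rev]; exact (hlt c hc).le
        · exact h2 c hc d hd hcd, by rw [Finset.card_insert_of_notMem hws]⟩
    have := le_csSup hba this
    omega

noncomputable def auxL2 {α : Type*} [Fintype α] (v : α → ℝ) : ℝ := Real.sqrt (∑ i, (v i) ^ 2)

theorem auxL2_eq {α : Type*} [Fintype α] (v : α → ℝ) : auxL2 v = ‖(WithLp.toLp 2 v : EuclideanSpace ℝ α)‖ := by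
  simp [auxL2, EuclideanSpace.norm_eq]

theorem auxL2_nonneg {α : Type*} [Fintype α] (v : α → ℝ) : 0 ≤ auxL2 v := Real.sqrt_nonneg _

theorem auxL2_sq {α : Type*} [Fintype α] (v : α → ℝ) : auxL2 v ^ 2 = ∑ i, v i ^ 2 :=
  Real.sq_sqrt (Finset.sum_nonneg fun _ _ => sq_nonneg _)

theorem auxL2_add {α : Type*} [Fintype α] (v w : α → ℝ) : auxL2 (v + w) ≤ auxL2 v + auxL2 w := by
  simp only [auxL2_eq, WithLp.toLp_add]; exact norm_add_le _ _

noncomputable def auxIp {n : ℕ} (τ : Fin n → Bool) (v : Fin n → ℝ) : ℝ :=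
  ∑ i, (if τ i then (1 : ℝ) else -1) * v i

theorem auxIp_sub {n : ℕ} (τ : Fin n → Bool) (v w : Fin n → ℝ) :
    auxIp τ (v - w) = auxIp τ v - auxIp τ w := by
  simp [auxIp, mul_sub, Finset.sum_sub_distrib]

theorem auxIp_le {n : ℕ} (τ : Fin n → Bool) (v : Fin n → ℝ) :
    auxIp τ v ≤ Real.sqrt n * auxL2 v := by
  refine (Real.sum_mul_le_sqrt_mul_sqrt _ _ _).trans ?_
  apply le_of_eq
  rw [auxL2]
  congr 2
  have : ∀ i, (if τ i then (1 : ℝ) else -1) ^ 2 = 1 := fun i => by split_ifs <;> norm_num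
  simp [this]

theorem aux_mgf {n : ℕ} (v : Fin n → ℝ) (l : ℝ) :
    ∑ τ : Fin n → Bool, Real.exp (l * auxIp τ v) ≤ 2 ^ n * Real.exp (l ^ 2 * auxL2 v ^ 2 / 2) := by
  have e : ∀ τ : Fin n → Bool, Real.exp (l * auxIp τ v) =
      ∏ i, Real.exp (l * ((if τ i then (1 : ℝ) else -1) * v i)) := fun τ => by
    rw [auxIp, Finset.mul_sum, Real.exp_sum]
  simp only [e]
  have := (Finset.prod_univ_sum (fun _ : Fin n => (Finset.univ : Finset Bool))
    (fun i b => Real.exp (l * ((if b then (1 : ℝ) else -1) * v i)))).symm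
  rw [Fintype.piFinset_univ] at this
  rw [this, auxL2_sq, Finset.mul_sum, Finset.sum_div, Real.exp_sum]
  calc _ ≤ ∏ i, (2 * Real.exp (l ^ 2 * v i ^ 2 / 2)) := by
        apply Finset.prod_le_prod
        · intro i _; positivity
        · intro i _
          have := Real.cosh_le_exp_half_sq (l * v i)
          rw [Real.cosh_eq, mul_pow] at this
          simp
          linarith
    _ = _ := by rw [Finset.prod_mul_distrib]; simp

theorem aux_massart {n : ℕ} {ι : Type*} (U : Finset ι) (hU : U.Nonempty) (v : ι → Fin n → ℝ)
    (R H : ℝ) (hR : 0 < R) (hH : 0 ≤ H) (hv : ∀ u ∈ U, auxL2 (v u) ≤ R)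
    (hc : Real.log U.card ≤ H) :
    ∑ τ : Fin n → Bool, U.sup' hU (fun u => auxIp τ (v u)) ≤ 2 ^ n * (R * Real.sqrt (2 * H)) := by
  have key : ∀ l : ℝ, 0 < l → l * ∑ τ : Fin n → Bool, U.sup' hU (fun u => auxIp τ (v u)) ≤
      2 ^ n * (H + l ^ 2 * R ^ 2 / 2) := by
    intro l hl
    have hcpos : (0 : ℝ) < U.card := by exact_mod_cast Finset.card_pos.2 hU
    set A : ℝ := U.card * Real.exp (l ^ 2 * R ^ 2 / 2) with hA
    have hA0 : 0 < A := by positivity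
    have hlogA : Real.log A ≤ H + l ^ 2 * R ^ 2 / 2 := by
      rw [hA, Real.log_mul hcpos.ne' (Real.exp_ne_zero _), Real.log_exp]; linarith
    have h1 : ∀ τ : Fin n → Bool, l * U.sup' hU (fun u => auxIp τ (v u)) ≤
        Real.log A - 1 + (∑ u ∈ U, Real.exp (l * auxIp τ (v u))) / A := by
      intro τ
      obtain ⟨u, hu, he⟩ := Finset.exists_mem_eq_sup' hU (fun u => auxIp τ (v u))
      rw [he]
      have h2 := Real.add_one_le_exp (l * auxIp τ (v u) - Real.log A)
      rw [Real.exp_sub, Real.exp_log hA0] at h2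
      have h3 : Real.exp (l * auxIp τ (v u)) ≤ ∑ u ∈ U, Real.exp (l * auxIp τ (v u)) :=
        Finset.single_le_sum (f := fun u => Real.exp (l * auxIp τ (v u)))
          (fun _ _ => (Real.exp_pos _).le) hu
      have := div_le_div_of_nonneg_right h3 hA0.le
      linarith
    have h4 : ∑ τ : Fin n → Bool, ∑ u ∈ U, Real.exp (l * auxIp τ (v u)) ≤ 2 ^ n * A := by
      rw [Finset.sum_comm]
      calc _ ≤ ∑ u ∈ U, 2 ^ n * Real.exp (l ^ 2 * R ^ 2 / 2) := by
            apply Finset.sum_le_sum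
            intro u hu
            refine (aux_mgf (v u) l).trans ?_
            have := hv u hu
            have := auxL2_nonneg (v u)
            gcongr
        _ = _ := by rw [Finset.sum_const, nsmul_eq_mul, hA]; ring
    rw [Finset.mul_sum]
    calc _ ≤ ∑ τ : Fin n → Bool, (Real.log A - 1 + (∑ u ∈ U, Real.exp (l * auxIp τ (v u))) / A) :=
          Finset.sum_le_sum fun τ _ => h1 τ
      _ = 2 ^ n * (Real.log A - 1) +
          (∑ τ : Fin n → Bool, ∑ u ∈ U, Real.exp (l * auxIp τ (v u))) / A := by
          rw [Finset.sum_add_distrib, ← Finset.sum_div]; simp; ring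
      _ ≤ 2 ^ n * (Real.log A - 1) + 2 ^ n := by
          gcongr
          rwa [div_le_iff₀ hA0]
      _ = 2 ^ n * Real.log A := by ring
      _ ≤ _ := by gcongr
  rcases hH.eq_or_lt with h0 | hH
  · subst h0
    simp only [mul_zero, Real.sqrt_zero]
    by_contra! hcon
    set Z := ∑ τ : Fin n → Bool, U.sup' hU (fun u => auxIp τ (v u))
    have := key (Z / (2 ^ n * R ^ 2)) (by positivity)
    have e : (2 : ℝ) ^ n * (0 + (Z / (2 ^ n * R ^ 2)) ^ 2 * R ^ 2 / 2) = Z / (2 ^ n * R ^ 2) * Z / 2 := by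
      field_simp; ring
    rw [e] at this
    have : 0 < Z / (2 ^ n * R ^ 2) * Z := by positivity
    linarith
  · set q := Real.sqrt (2 * H) with hq
    have hq0 : 0 < q := Real.sqrt_pos.2 (by positivity)
    have hq2 : q ^ 2 = 2 * H := Real.sq_sqrt (by positivity)
    have := key (q / R) (by positivity)
    have e : (2 : ℝ) ^ n * (H + (q / R) ^ 2 * R ^ 2 / 2) = (q / R) * (2 ^ n * (R * q)) := by
      have : H = q ^ 2 / 2 := by linarith
      rw [this]; field_simp; ring
    rw [e] at this
    exact le_of_mul_le_mul_left this (by positivity)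

theorem aux_sup_step {n : ℕ} (U V : Finset (Fin n → ℝ)) (hU : U.Nonempty) (hV : V.Nonempty)
    (π : (Fin n → ℝ) → (Fin n → ℝ)) (hπ : ∀ u ∈ V, π u ∈ U) (τ : Fin n → Bool) :
    V.sup' hV (fun u => auxIp τ u) ≤
      U.sup' hU (fun u => auxIp τ u) + V.sup' hV (fun u => auxIp τ (u - π u)) := by
  apply Finset.sup'_le
  intro u hu
  have h1 := Finset.le_sup' (f := fun u => auxIp τ u) (hπ u hu)
  have h2 := Finset.le_sup' (f := fun u => auxIp τ (u - π u)) hu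
  have h3 := auxIp_sub τ u (π u)
  linarith

theorem aux_term (N B q : ℝ) (hN : 0 < N) (hB : 0 ≤ B) (hq : 0 < q) :
    16 * (Real.sqrt N * q ^ 4) * Real.sqrt (2 * Real.sqrt (B / (Real.sqrt N * q ^ 4))) ≤
      16 * N ^ ((3 : ℝ) / 8) * B ^ ((1 : ℝ) / 4) * (7 * q ^ 3) := by
  have e : Real.sqrt (2 * Real.sqrt (B / (Real.sqrt N * q ^ 4))) =
      Real.sqrt 2 * (B ^ ((1 : ℝ) / 4) / (N ^ ((1 : ℝ) / 8) * q)) := by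
    rw [Real.sqrt_mul (by norm_num)]
    congr 1
    have : (q ^ 4) ^ ((1:ℝ)/4) = q := by
      rw [← Real.rpow_natCast, ← Real.rpow_mul hq.le]; norm_num
    rw [Real.sqrt_eq_rpow, Real.sqrt_eq_rpow, Real.sqrt_eq_rpow, ← Real.rpow_mul (by positivity),
      Real.div_rpow hB (by positivity), Real.mul_rpow (by positivity) (by positivity),
      ← Real.rpow_mul hN.le]
    norm_num at this ⊢
    rw [this]
  have e2 : Real.sqrt N = N ^ ((3 : ℝ) / 8) * N ^ ((1 : ℝ) / 8) := by
    rw [← Real.rpow_add hN, Real.sqrt_eq_rpow]; norm_num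
  rw [e, e2]
  have h2 : Real.sqrt 2 ≤ 7 := by rw [Real.sqrt_le_left (by norm_num)]; norm_num
  have h8 : 0 < N ^ ((1 : ℝ) / 8) := by positivity
  have : 16 * (N ^ ((3 : ℝ) / 8) * N ^ ((1 : ℝ) / 8) * q ^ 4) *
      (Real.sqrt 2 * (B ^ ((1 : ℝ) / 4) / (N ^ ((1 : ℝ) / 8) * q))) =
      16 * N ^ ((3 : ℝ) / 8) * B ^ ((1 : ℝ) / 4) * (Real.sqrt 2 * q ^ 3) := by
    field_simp
  rw [this]
  gcongr

theorem aux_chain {n : ℕ} (hn : 1 ≤ n) (T : Set (Fin n → ℝ)) (B : ℝ) (hB : 0 ≤ B)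
    (hT : ∀ t ∈ T, auxL2 t ≤ Real.sqrt n)
    (hcov : ∀ ε : ℝ, 0 < ε → ∃ U : Finset (Fin n → ℝ), U.Nonempty ∧ (∀ u ∈ U, u ∈ T) ∧
      Real.log U.card ≤ Real.sqrt (B / ε) ∧ ∀ t ∈ T, ∃ u ∈ U, auxL2 (t - u) ≤ ε)
    (G : (Fin n → Bool) → ℝ)
    (hG : ∀ τ z, (∀ t ∈ T, auxIp τ t ≤ z) → G τ ≤ z) :
    ∑ τ, G τ ≤ 2 ^ n * (16 * (n : ℝ) ^ ((3 : ℝ) / 8) * B ^ ((1 : ℝ) / 4)) := by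
  have hN : (0 : ℝ) < n := by exact_mod_cast hn
  have hsN : 0 < Real.sqrt n := Real.sqrt_pos.2 hN
  set K := 16 * (n : ℝ) ^ ((3 : ℝ) / 8) * B ^ ((1 : ℝ) / 4) with hK
  have hK0 : 0 ≤ K := by positivity
  let q : ℕ → ℝ := fun j => (1 / 2) ^ j
  have hq : ∀ j, 0 < q j := fun j => by positivity
  let ε : ℕ → ℝ := fun j => Real.sqrt n * q j ^ 4
  have hε : ∀ j, 0 < ε j := fun j => by have := hq j; positivity
  have hεs : ∀ j, ε j = 16 * ε (j + 1) := fun j => by simp only [ε, q]; rw [pow_succ]; ring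
  choose U hUne hUT hUc hUcov using fun j => hcov (ε j) (hε j)
  have main : ∀ j, ∑ τ : Fin n → Bool, (U (j + 1)).sup' (hUne _) (fun u => auxIp τ u) ≤
      2 ^ n * (K * (1 - q (j + 1) ^ 3)) := by
    intro j
    induction j with
    | zero =>
      have h := aux_massart (U 1) (hUne 1) (fun u => u) (ε 0) _ (hε 0) (Real.sqrt_nonneg _)
        (fun u hu => by simpa [ε, q] using hT u (hUT 1 u hu)) (hUc 1)
      refine h.trans ?_
      have := aux_term n B (q 1) hN hB (hq 1)
      rw [hεs 0]
      refine mul_le_mul_of_nonneg_left ?_ (by positivity)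
      refine this.trans (le_of_eq ?_)
      simp only [q, hK]; norm_num
    | succ j ih =>
      have hex : ∀ u, ∃ w, u ∈ U (j + 2) → w ∈ U (j + 1) ∧ auxL2 (u - w) ≤ ε (j + 1) := by
        intro u
        by_cases hu : u ∈ U (j + 2)
        · obtain ⟨w, hw⟩ := hUcov (j + 1) u (hUT _ u hu)
          exact ⟨w, fun _ => hw⟩
        · exact ⟨0, fun h => absurd h hu⟩
      choose π hπ using hex
      have h := aux_massart (U (j + 2)) (hUne _) (fun u => u - π u) (ε (j + 1)) _ (hε _)
        (Real.sqrt_nonneg _) (fun u hu => (hπ u hu).2) (hUc (j + 2))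
      have hst : ∑ τ : Fin n → Bool, (U (j + 2)).sup' (hUne _) (fun u => auxIp τ u) ≤
          ∑ τ : Fin n → Bool, ((U (j + 1)).sup' (hUne _) (fun u => auxIp τ u) +
            (U (j + 2)).sup' (hUne _) (fun u => auxIp τ (u - π u))) :=
        Finset.sum_le_sum fun τ _ => aux_sup_step _ _ _ _ π (fun u hu => (hπ u hu).1) τ
      rw [Finset.sum_add_distrib] at hst
      have ht := aux_term n B (q (j + 2)) hN hB (hq _)
      rw [hεs (j + 1)] at h
      have e : 2 ^ n * (K * (1 - q (j + 1 + 1) ^ 3)) =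
        2 ^ n * (K * (1 - q (j + 1) ^ 3)) + 2 ^ n * (K * (7 * q (j + 2) ^ 3)) := by
        simp only [q]; ring
      have : (2 : ℝ) ^ n * (16 * ε (j + 1 + 1) * Real.sqrt (2 * Real.sqrt (B / ε (j + 2)))) ≤
          2 ^ n * (K * (7 * q (j + 2) ^ 3)) := by
        gcongr
      rw [e]
      linarith
  have fin : ∀ j, ∑ τ, G τ ≤ 2 ^ n * K + 2 ^ n * (n * (1 / 16) ^ (j + 1)) := by
    intro j
    have h1 : ∀ τ, G τ ≤ (U (j + 1)).sup' (hUne _) (fun u => auxIp τ u) + n * (1 / 16) ^ (j + 1) := by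
      intro τ
      apply hG
      intro t ht
      obtain ⟨u, hu, hd⟩ := hUcov (j + 1) t ht
      have h2 := Finset.le_sup' (f := fun u => auxIp τ u) hu
      have h3 := auxIp_sub τ t u
      have h4 := auxIp_le τ (t - u)
      have h5 : Real.sqrt n * auxL2 (t - u) ≤ Real.sqrt n * ε (j + 1) := by gcongr
      have h6 : Real.sqrt n * ε (j + 1) = n * (1 / 16) ^ (j + 1) := by
        simp only [ε, q]
        rw [← mul_assoc, Real.mul_self_sqrt hN.le, ← pow_mul, mul_comm (j + 1) 4, pow_mul]
        norm_num
      linarith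
    have h2 := Finset.sum_le_sum (fun τ (_ : τ ∈ Finset.univ) => h1 τ)
    rw [Finset.sum_add_distrib] at h2
    have h3 : ∑ τ : Fin n → Bool, (n : ℝ) * (1 / 16) ^ (j + 1) = 2 ^ n * (n * (1 / 16) ^ (j + 1)) := by
      simp
    have h4 := main j
    have h5 : (2 : ℝ) ^ n * (K * (1 - q (j + 1) ^ 3)) ≤ 2 ^ n * K := by
      have := hq (j + 1)
      have : K * (1 - q (j + 1) ^ 3) ≤ K * 1 := by
        gcongr
        have := pow_pos this 3
        linarith
      rw [mul_one] at this
      gcongr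
    linarith
  have lim : Filter.Tendsto (fun j : ℕ => 2 ^ n * K + 2 ^ n * ((n : ℝ) * (1 / 16) ^ (j + 1)))
      Filter.atTop (nhds (2 ^ n * K + 2 ^ n * ((n : ℝ) * 0))) := by
    refine Filter.Tendsto.const_add _ (Filter.Tendsto.const_mul _ (Filter.Tendsto.const_mul _ ?_))
    exact (tendsto_pow_atTop_nhds_zero_of_lt_one (by norm_num) (by norm_num)).comp
      (Filter.tendsto_add_atTop_nat 1)
  have := ge_of_tendsto' lim fin
  simpa using this

theorem aux_frob_eq {α β : Type*} [Fintype α] [Fintype β] (M : Matrix α β ℝ) :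
    frobNorm M = auxL2 (fun p : α × β => M p.1 p.2) := by
  rw [frobNorm, auxL2, Fintype.sum_prod_type]

theorem aux_spec_mulVec {α β : Type*} [Fintype α] [Fintype β] [DecidableEq β]
    (M : Matrix α β ℝ) (v : β → ℝ) : auxL2 (M.mulVec v) ≤ specNorm M * auxL2 v := by
  rw [auxL2_eq, auxL2_eq]
  have := (LinearMap.toContinuousLinearMap (Matrix.toEuclideanLin M)).le_opNorm (WithLp.toLp 2 v)
  simpa [specNorm] using this

theorem aux_spec_nonneg {α β : Type*} [Fintype α] [Fintype β] [DecidableEq β]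
    (M : Matrix α β ℝ) : 0 ≤ specNorm M := norm_nonneg _

theorem aux_spec_le_frob {α β : Type*} [Fintype α] [Fintype β] [DecidableEq β]
    (M : Matrix α β ℝ) : specNorm M ≤ frobNorm M := by
  have hf : 0 ≤ frobNorm M := Real.sqrt_nonneg _
  refine ContinuousLinearMap.opNorm_le_bound _ hf ?_
  intro v
  have h1 : ‖(LinearMap.toContinuousLinearMap (Matrix.toEuclideanLin M)) v‖ =
      auxL2 (M.mulVec v.ofLp) := by
    rw [auxL2_eq]; simp [Matrix.toLpLin_apply]
  have h2 : ‖v‖ = auxL2 v.ofLp := by rw [auxL2_eq]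
  rw [h1, h2]
  refine (abs_le_of_sq_le_sq' ?_ (mul_nonneg hf (auxL2_nonneg _))).2
  have hf2 : frobNorm M ^ 2 = ∑ i, ∑ j, (M i j) ^ 2 := Real.sq_sqrt (by positivity)
  rw [mul_pow, hf2, auxL2_sq (M.mulVec v.ofLp), auxL2_sq v.ofLp, Finset.sum_mul]
  apply Finset.sum_le_sum
  intro i _
  exact Finset.sum_mul_sq_le_sq_mul_sq _ _ _

theorem aux_gamma_sub {c r d m : ℕ} (S : Fin m → Fin r → Fin d)
    (W W' : Matrix (Fin c) (Fin r) ℝ) : gamma S W - gamma S W' = gamma S (W - W') := by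
  ext ik j
  simp only [gamma, Matrix.sub_apply, ← Finset.sum_sub_distrib]
  refine Finset.sum_congr rfl fun p _ => ?_
  split_ifs <;> simp

theorem aux_row {r d : ℕ} (S : Fin r → Fin d) (hS : Function.Injective S) (w : Fin r → ℝ) :
    ∑ j, (∑ p, if S p = j then w p else 0) ^ 2 = ∑ p, w p ^ 2 := by
  have h : ∀ j, (∑ p, if S p = j then w p else 0) ^ 2 = ∑ p, if S p = j then w p ^ 2 else 0 := by
    intro j
    by_cases hj : ∃ p0, S p0 = j
    · obtain ⟨p0, rfl⟩ := hj
      simp [hS.eq_iff]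
    · push Not at hj
      simp [hj]
  simp only [h]
  rw [Finset.sum_comm]
  simp

theorem aux_gamma_frob {c r d m : ℕ} (S : Fin m → Fin r → Fin d)
    (hS : ∀ k, Function.Injective (S k)) (W : Matrix (Fin c) (Fin r) ℝ) :
    frobNorm (gamma S W) ≤ Real.sqrt (((c * m : ℕ) : ℝ) / (c : ℝ)) * frobNorm W := by
  rcases Nat.eq_zero_or_pos c with rfl | hc
  · simp [frobNorm]
  have : (((c * m : ℕ) : ℝ) / (c : ℝ)) = m := by
    have : (c : ℝ) ≠ 0 := by positivity
    push_cast; field_simp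
  rw [this, frobNorm, frobNorm, ← Real.sqrt_mul (by positivity)]
  apply le_of_eq
  congr 1
  rw [Fintype.sum_prod_type]
  simp only [gamma, aux_row _ (hS _)]
  simp [Finset.mul_sum]

theorem aux_frob_reindex {α β α' β' : Type*} [Fintype α] [Fintype β] [Fintype α'] [Fintype β']
    (e : α ≃ α') (f : β ≃ β') (M : Matrix α β ℝ) :
    frobNorm (Matrix.reindex e f M) = frobNorm M := by
  rw [frobNorm, frobNorm]
  congr 1
  simp only [Matrix.reindex_apply, Matrix.submatrix_apply]
  rw [Equiv.sum_comp e.symm (fun i => ∑ j, M i (f.symm j) ^ 2)]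
  exact Finset.sum_congr rfl fun i _ => Equiv.sum_comp f.symm (fun j => M i j ^ 2)

theorem aux_ramp_eq (η r : ℝ) (hη : 0 < η) : rampFn η r = max 0 (min 1 (1 + r / η)) := by
  unfold rampFn
  split_ifs with h1 h2
  · have : r / η < -1 := by rw [div_lt_iff₀ hη]; linarith
    rw [max_eq_left]
    exact (min_le_right _ _).trans (by linarith)
  · have h3 : -1 ≤ r / η := by rw [le_div_iff₀ hη]; linarith
    have h4 : r / η ≤ 0 := div_nonpos_of_nonpos_of_nonneg h2 hη.le
    rw [min_eq_right (by linarith), max_eq_right (by linarith)]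
  · have : 0 < r / η := div_pos (by linarith) hη
    rw [min_eq_left (by linarith), max_eq_right (by linarith)]

theorem aux_ramp_lip (η r r' : ℝ) (hη : 0 < η) : |rampFn η r - rampFn η r'| ≤ |r - r'| / η := by
  rw [aux_ramp_eq _ _ hη, aux_ramp_eq _ _ hη]
  have h1 := abs_max_sub_max_le_max 0 (min 1 (1 + r / η)) 0 (min 1 (1 + r' / η))
  have h2 := abs_min_sub_min_le_max 1 (1 + r / η) 1 (1 + r' / η)
  have h3 : 1 + r / η - (1 + r' / η) = (r - r') / η := by ring
  rw [h3, abs_div, abs_of_pos hη] at h2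
  simp only [sub_self, abs_zero] at h1 h2
  have h4 : 0 ≤ |r - r'| / η := by positivity
  rw [max_eq_right h4] at h2
  rw [max_eq_right (abs_nonneg (min 1 (1 + r / η) - min 1 (1 + r' / η)))] at h1
  exact h1.trans h2

theorem aux_coord {α : Type*} [Fintype α] (v : α → ℝ) (j : α) : |v j| ≤ auxL2 v := by
  rw [auxL2, ← Real.sqrt_sq_eq_abs]
  exact Real.sqrt_le_sqrt (Finset.single_le_sum (f := fun j => v j ^ 2)
    (fun _ _ => sq_nonneg _) (Finset.mem_univ j))

theorem aux_ssup {k : ℕ} (v v' : Fin k → ℝ) (S : Set (Fin k)) (b : ℝ) (hb : 0 ≤ b)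
    (h : ∀ j, v j ≤ v' j + b) : sSup (v '' S) ≤ sSup (v' '' S) + b := by
  rcases S.eq_empty_or_nonempty with rfl | hS
  · simpa using hb
  apply csSup_le (hS.image _)
  rintro _ ⟨j, hj, rfl⟩
  have := le_csSup (S.toFinite.image v').bddAbove (Set.mem_image_of_mem v' hj)
  linarith [h j]

theorem aux_loss_lip {k : ℕ} (η : ℝ) (hη : 0 < η) (v v' : Fin k → ℝ) (y : Fin k) :
    |rampLoss η v y - rampLoss η v' y| ≤ 2 / η * auxL2 (v - v') := by
  unfold rampLoss
  refine (aux_ramp_lip η _ _ hη).trans ?_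
  have hb := auxL2_nonneg (v - v')
  have hc : ∀ j, |v j - v' j| ≤ auxL2 (v - v') := fun j => aux_coord (v - v') j
  have h1 := aux_ssup v v' {j | j ≠ y} _ hb (fun j => by have := abs_le.1 (hc j); linarith)
  have h2 := aux_ssup v' v {j | j ≠ y} _ hb (fun j => by have := abs_le.1 (hc j); linarith)
  have h3 := abs_le.1 (hc y)
  have : |-(v y - sSup (v '' {j | j ≠ y})) - -(v' y - sSup (v' '' {j | j ≠ y}))|
      ≤ 2 * auxL2 (v - v') := by
    rw [abs_le]; constructor <;> linarith
  rw [div_mul_eq_mul_div]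
  gcongr

theorem aux_loss_abs {k : ℕ} (η : ℝ) (hη : 0 < η) (v : Fin k → ℝ) (y : Fin k) :
    rampLoss η v y ^ 2 ≤ 1 := by
  unfold rampLoss
  rw [aux_ramp_eq _ _ hη]
  set z := min 1 (1 + -(v y - sSup (v '' {j | j ≠ y})) / η)
  have h1 : z ≤ 1 := min_le_left _ _
  have h2 : max 0 z ≤ 1 := max_le (by norm_num) h1
  have h3 : 0 ≤ max 0 z := le_max_left _ _
  nlinarith

theorem aux_net (L : ℕ) (d : ℕ → ℕ)
    (σ : ∀ i : ℕ, (Fin (d (i+1)) → ℝ) → (Fin (d (i+1)) → ℝ))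
    (ρ s : ℕ → ℝ)
    (hρ : ∀ i < L, 0 ≤ ρ i) (hs : ∀ i < L, 0 < s i)
    (hσ : ∀ i < L, ∀ u v : Fin (d (i+1)) → ℝ, auxL2 (σ i u - σ i v) ≤ ρ i * auxL2 (u - v))
    (hσ0 : ∀ i < L, σ i 0 = 0)
    (C C' : ∀ i : ℕ, Matrix (Fin (d (i+1))) (Fin (d i)) ℝ)
    (hC : ∀ i < L, specNorm (C i) ≤ s i) (hC' : ∀ i < L, specNorm (C' i) ≤ s i)
    (x : Fin (d 0) → ℝ) (l : ℕ) (hl : l ≤ L) :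
    0 ≤ (∏ i ∈ Finset.range l, ρ i * s i) ∧
    auxL2 (netVec d C' σ x l) ≤ (∏ i ∈ Finset.range l, ρ i * s i) * auxL2 x ∧
    auxL2 (netVec d C σ x l - netVec d C' σ x l) ≤ (∏ i ∈ Finset.range l, ρ i * s i) * auxL2 x *
      ∑ i ∈ Finset.range l, specNorm (C i - C' i) / s i := by
  induction l with
  | zero => simp [netVec, auxL2]
  | succ l ih =>
    obtain ⟨h0, h1, h2⟩ := ih (by omega)
    have hlL : l < L := by omega
    have r0 := hρ l hlL
    have s0 := hs l hlL
    have hx := auxL2_nonneg x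
    rw [Finset.prod_range_succ, Finset.sum_range_succ]
    set P := ∏ i ∈ Finset.range l, ρ i * s i
    set Q := ∑ i ∈ Finset.range l, specNorm (C i - C' i) / s i
    set u := netVec d C σ x l with hu
    set u' := netVec d C' σ x l with hu'
    have e : netVec d C σ x (l+1) = σ l ((C l).mulVec u) := rfl
    have e' : netVec d C' σ x (l+1) = σ l ((C' l).mulVec u') := rfl
    have hu0 := auxL2_nonneg u'
    refine ⟨by positivity, ?_, ?_⟩
    · rw [e']
      have := hσ l hlL ((C' l).mulVec u') 0
      rw [hσ0 l hlL, sub_zero, sub_zero] at this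
      calc _ ≤ _ := this
        _ ≤ ρ l * (s l * (P * auxL2 x)) := by
          gcongr
          refine (aux_spec_mulVec _ _).trans ?_
          have := hC' l hlL
          gcongr
        _ = _ := by ring
    · rw [e, e']
      have hsp := aux_spec_nonneg (C l - C' l)
      calc _ ≤ _ := hσ l hlL _ _
        _ ≤ ρ l * (s l * (P * auxL2 x * Q) + specNorm (C l - C' l) * (P * auxL2 x)) := by
          gcongr
          have e3 : (C l).mulVec u - (C' l).mulVec u' =
              (C l).mulVec (u - u') + (C l - C' l).mulVec u' := by
            rw [Matrix.mulVec_sub, Matrix.sub_mulVec]; abel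
          rw [e3]
          refine (auxL2_add _ _).trans ?_
          refine add_le_add ((aux_spec_mulVec _ _).trans ?_) ((aux_spec_mulVec _ _).trans ?_)
          · exact mul_le_mul (hC l hlL) h2 (auxL2_nonneg _) s0.le
          · gcongr
        _ = _ := by field_simp

theorem aux_log_le (x : ℝ) (hx : 0 ≤ x) : Real.log (1 + x) ≤ Real.sqrt x := by
  rw [Real.log_le_iff_le_exp (by positivity)]
  set q := Real.sqrt x with hq
  have h0 : 0 ≤ q := Real.sqrt_nonneg _
  have : x = q ^ 2 := (Real.sq_sqrt hx).symm
  rw [this]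
  have h := Real.sum_le_exp_of_nonneg h0 4
  simp [Finset.sum_range_succ, Nat.factorial] at h
  nlinarith [mul_nonneg h0 (sq_nonneg (q - 3/2)), mul_nonneg h0 (sq_nonneg (2 * q - 3))]

open Module in
theorem aux_layer {E M : Type*} [NormedAddCommGroup E] [NormedSpace ℝ E] [FiniteDimensional ℝ E]
    (φ : E → M) (D : M → M → ℝ) (K : Set E) (hK : K.Nonempty) (a κ b δ : ℝ) (ha : 0 ≤ a)
    (hκ : 0 ≤ κ) (hb : 0 ≤ b) (hδ : 0 < δ) (hKa : ∀ w ∈ K, ‖w‖ ≤ a)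
    (hD : ∀ w w', D (φ w) (φ w') ≤ κ * ‖w - w'‖) :
    ∃ U : Finset M, U.Nonempty ∧ (∀ u ∈ U, u ∈ φ '' K) ∧
      Real.log U.card ≤ finrank ℝ E * Real.sqrt (2 * (a * (κ * b)) / δ) ∧
      ∀ C ∈ φ '' K, ∃ u ∈ U, b * D C u ≤ δ := by
  classical
  obtain ⟨U, h1, h2, h3, h4⟩ := aux_cover K hK a δ (κ * b) ha hδ (by positivity) hKa
  refine ⟨U.image φ, h1.image _, ?_, ?_, ?_⟩
  · intro u hu
    obtain ⟨w, hw, rfl⟩ := Finset.mem_image.1 hu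
    exact ⟨w, h2 w hw, rfl⟩
  · have hpos : (0 : ℝ) < (U.image φ).card := by exact_mod_cast Finset.card_pos.2 (h1.image _)
    have hle : ((U.image φ).card : ℝ) ≤ U.card := by exact_mod_cast Finset.card_image_le
    have := Real.log_le_log hpos (hle.trans h3)
    rw [Real.log_pow] at this
    refine this.trans ?_
    gcongr
    exact aux_log_le _ (by positivity)
  · rintro _ ⟨w, hw, rfl⟩
    obtain ⟨u, hu, h⟩ := h4 w hw
    refine ⟨φ u, Finset.mem_image_of_mem _ hu, le_trans ?_ h⟩
    have := mul_le_mul_of_nonneg_left (hD w u) hb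
    linarith

theorem aux_layerA (p q : ℕ) (s a b δ : ℝ) (hs : 0 ≤ s) (ha : 0 ≤ a) (hb : 0 ≤ b) (hδ : 0 < δ) :
    ∃ U : Finset (Matrix (Fin p) (Fin q) ℝ), U.Nonempty ∧
      (∀ u ∈ U, specNorm u ≤ s ∧ frobNorm u ≤ a) ∧
      Real.log U.card ≤ ((p : ℝ) * q) * Real.sqrt (2 * (a * (1 * b)) / δ) ∧
      ∀ C, specNorm C ≤ s → frobNorm C ≤ a → ∃ u ∈ U, b * specNorm (C - u) ≤ δ := by
  let φ : EuclideanSpace ℝ (Fin p × Fin q) → Matrix (Fin p) (Fin q) ℝ := fun w i j => w (i, j)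
  have hφ : ∀ w, frobNorm (φ w) = ‖w‖ := fun w => by rw [aux_frob_eq, auxL2_eq]
  have hφs : ∀ w w', φ w - φ w' = φ (w - w') := fun w w' => rfl
  have hφ0 : φ 0 = 0 := rfl
  obtain ⟨U, h1, h2, h3, h4⟩ := aux_layer φ (fun A B => specNorm (A - B))
    {w | specNorm (φ w) ≤ s ∧ frobNorm (φ w) ≤ a}
    ⟨0, by rw [Set.mem_ofPred_eq, hφ0]; exact ⟨by simpa [specNorm] using hs, by simpa [frobNorm] using ha⟩⟩
    a 1 b δ ha zero_le_one hb hδ (fun w hw => by rw [← hφ]; exact hw.2)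
    (fun w w' => by
      rw [hφs, one_mul, ← hφ]; exact aux_spec_le_frob _)
  refine ⟨U, h1, ?_, ?_, ?_⟩
  · intro u hu
    obtain ⟨w, hw, rfl⟩ := h2 u hu
    exact hw
  · simpa using h3
  · intro C hC hC'
    exact h4 C ⟨WithLp.toLp 2 (fun p => C p.1 p.2), ⟨hC, hC'⟩, rfl⟩

theorem aux_layerW (p q c r m : ℕ) (hp : p = c * m) (S : Fin m → Fin r → Fin q)
    (hS : ∀ k, Function.Injective (S k)) (s a b δ : ℝ)
    (hs : 0 ≤ s) (ha : 0 ≤ a) (hb : 0 ≤ b) (hδ : 0 < δ) :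
    ∃ U : Finset (Matrix (Fin p) (Fin q) ℝ), U.Nonempty ∧
      (∀ u ∈ U, specNorm u ≤ s ∧ ∃ W : Matrix (Fin c) (Fin r) ℝ, frobNorm W ≤ a ∧
        u = Matrix.reindex (finProdFinEquiv.trans (finCongr hp.symm))
              (Equiv.refl (Fin q)) (gamma S W)) ∧
      Real.log U.card ≤ ((c : ℝ) * r) *
        Real.sqrt (2 * (a * (Real.sqrt ((p : ℝ) / (c : ℝ)) * b)) / δ) ∧
      ∀ C, specNorm C ≤ s → (∃ W : Matrix (Fin c) (Fin r) ℝ, frobNorm W ≤ a ∧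
        C = Matrix.reindex (finProdFinEquiv.trans (finCongr hp.symm))
              (Equiv.refl (Fin q)) (gamma S W)) → ∃ u ∈ U, b * specNorm (C - u) ≤ δ := by
  let ψ : EuclideanSpace ℝ (Fin c × Fin r) → Matrix (Fin c) (Fin r) ℝ := fun w i j => w (i, j)
  have hψ : ∀ w, frobNorm (ψ w) = ‖w‖ := fun w => by rw [aux_frob_eq, auxL2_eq]
  let θ : Matrix (Fin c) (Fin r) ℝ → Matrix (Fin p) (Fin q) ℝ := fun W =>
    Matrix.reindex (finProdFinEquiv.trans (finCongr hp.symm)) (Equiv.refl (Fin q)) (gamma S W)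
  have hθs : ∀ W W', θ W - θ W' = θ (W - W') := fun W W' => by
    simp only [θ]; rw [← aux_gamma_sub]; rfl
  have hθf : ∀ W, frobNorm (θ W) ≤ Real.sqrt ((p : ℝ) / (c : ℝ)) * frobNorm W := fun W => by
    simp only [θ]; rw [aux_frob_reindex, hp]; exact aux_gamma_frob S hS W
  have hψs : ∀ w w', ψ w - ψ w' = ψ (w - w') := fun w w' => rfl
  have hψ0 : ψ 0 = 0 := rfl
  have hθ0 : θ 0 = 0 := by have := hθs 0 0; rw [sub_self, sub_self] at this; exact this.symm
  obtain ⟨U, h1, h2, h3, h4⟩ := aux_layer (fun w => θ (ψ w)) (fun A B => specNorm (A - B))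
    {w | specNorm (θ (ψ w)) ≤ s ∧ frobNorm (ψ w) ≤ a}
    ⟨0, by
      rw [Set.mem_ofPred_eq, hψ0, hθ0]
      exact ⟨by simpa [specNorm] using hs, by simpa [frobNorm] using ha⟩⟩
    a (Real.sqrt ((p : ℝ) / (c : ℝ))) b δ ha (Real.sqrt_nonneg _) hb hδ
    (fun w hw => by rw [← hψ]; exact hw.2)
    (fun w w' => by
      rw [hθs, hψs, ← hψ]; exact (aux_spec_le_frob _).trans (hθf _))
  refine ⟨U, h1, ?_, ?_, ?_⟩
  · intro u hu
    obtain ⟨w, hw, rfl⟩ := h2 u hu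
    exact ⟨hw.1, ψ w, hw.2, rfl⟩
  · simpa using h3
  · rintro C hC ⟨W, hW, rfl⟩
    exact h4 _ ⟨WithLp.toLp 2 (fun p => W p.1 p.2), ⟨hC, hW⟩, rfl⟩

theorem aux_cs (L : ℕ) (p A : ℕ → ℝ) (hA : ∀ i < L, 0 ≤ A i) (ε : ℝ) (hε : 0 < ε) :
    ∑ i ∈ Finset.range L, p i * Real.sqrt (A i / (ε / L)) ≤
      Real.sqrt ((∑ i ∈ Finset.range L, (L : ℝ) ^ 2 * (p i ^ 2 * A i)) / ε) := by
  apply Real.le_sqrt_of_sq_le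
  refine sq_sum_le_card_mul_sum_sq.trans (le_of_eq ?_)
  rw [Finset.card_range, Finset.mul_sum, Finset.sum_div]
  refine Finset.sum_congr rfl fun i hi => ?_
  have := hA i (Finset.mem_range.1 hi)
  rw [mul_pow, Real.sq_sqrt (by positivity), div_div_eq_mul_div]
  field_simp

/-- the empirical Rademacher complexity of the ramp-loss class of CNNs with
weight bounds `(aᵢ)`, `(sᵢ)` and complexity `R_C` satisfies
`R_S(H_η) ≤ 16·n^{−5/8}·(2‖X‖_F·R_C/η)^{1/4}`. -/
theorem rademacher_ramp_loss_cnn (L n : ℕ) (hn : 1 ≤ n) (d c r m : ℕ → ℕ)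
    (SA SW : Finset ℕ) (hpart : SA ∪ SW = Finset.range L) (hdisj : Disjoint SA SW)
    (hd : ∀ i ∈ SW, d (i+1) = c i * m i)
    (Smap : ∀ i : ℕ, Fin (m i) → Fin (r i) → Fin (d i))
    (hSmap : ∀ i ∈ SW, ∀ k, Function.Injective (Smap i k))
    (σ : ∀ i : ℕ, (Fin (d (i+1)) → ℝ) → (Fin (d (i+1)) → ℝ))
    (ρ s a : ℕ → ℝ)
    (hρ : ∀ i < L, 0 ≤ ρ i) (hs : ∀ i < L, 0 < s i) (ha : ∀ i < L, 0 < a i)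
    (hσ : ∀ i < L, ∀ u v : Fin (d (i+1)) → ℝ,
      Real.sqrt (∑ j, (σ i u j - σ i v j) ^ 2) ≤ ρ i * Real.sqrt (∑ j, (u j - v j) ^ 2))
    (hσ0 : ∀ i < L, σ i 0 = 0)
    (x : Fin n → Fin (d 0) → ℝ) (y : Fin n → Fin (d L))
    (η : ℝ) (hη : 0 < η) :
    (1 / 2 ^ n : ℝ) * ∑ τ : Fin n → Bool,
      sSup { t : ℝ | ∃ C : ∀ i : ℕ, Matrix (Fin (d (i+1))) (Fin (d i)) ℝ,
        ((∀ i < L, specNorm (C i) ≤ s i) ∧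
         (∀ i ∈ SA, frobNorm (C i) ≤ a i) ∧
         (∀ i (hi : i ∈ SW), ∃ W : Matrix (Fin (c i)) (Fin (r i)) ℝ, frobNorm W ≤ a i ∧
            C i = Matrix.reindex (finProdFinEquiv.trans (finCongr (hd i hi).symm))
              (Equiv.refl (Fin (d i))) (gamma (Smap i) W))) ∧
        t = (1 / n : ℝ) * ∑ i, (if τ i then (1 : ℝ) else -1) *
              rampLoss η (netVec d C σ (x i) L) (y i) } ≤
    16 * (n : ℝ) ^ (-(5 : ℝ) / 8) *
      (2 * Real.sqrt (∑ i, ∑ j, (x i j) ^ 2) *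
        ((2 * ∏ i ∈ Finset.range L, ρ i * s i) *
          ((∑ i ∈ SA, (d (i+1) : ℝ) ^ 2 * (d i : ℝ) ^ 2 * a i / s i) +
           (∑ i ∈ SW,
             (c i : ℝ) ^ 2 * (r i : ℝ) ^ 2 * a i * Real.sqrt ((d (i+1) : ℝ) / (c i : ℝ)) / s i)) *
          (L : ℝ) ^ 2) / η) ^ ((1 : ℝ) / 4) := by
  
  classical
  have hσ' : ∀ i < L, ∀ u v : Fin (d (i+1)) → ℝ,
      auxL2 (σ i u - σ i v) ≤ ρ i * auxL2 (u - v) := fun i hi u v => hσ i hi u v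
  have hSA : ∀ i ∈ SA, i < L := fun i hi => Finset.mem_range.1 (hpart ▸ Finset.mem_union_left _ hi)
  have hSW : ∀ i ∈ SW, i < L := fun i hi => Finset.mem_range.1 (hpart ▸ Finset.mem_union_right _ hi)
  have hN : (0 : ℝ) < n := by exact_mod_cast hn
  set X := Real.sqrt (∑ i, ∑ j, (x i j) ^ 2) with hX
  have hX0 : 0 ≤ X := Real.sqrt_nonneg _
  set P := ∏ i ∈ Finset.range L, ρ i * s i with hP
  have hP0 : 0 ≤ P := Finset.prod_nonneg fun i hi =>
    mul_nonneg (hρ i (Finset.mem_range.1 hi)) (hs i (Finset.mem_range.1 hi)).le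
  let Ok : (∀ i : ℕ, Matrix (Fin (d (i+1))) (Fin (d i)) ℝ) → Prop := fun C =>
    ((∀ i < L, specNorm (C i) ≤ s i) ∧
         (∀ i ∈ SA, frobNorm (C i) ≤ a i) ∧
         (∀ i (hi : i ∈ SW), ∃ W : Matrix (Fin (c i)) (Fin (r i)) ℝ, frobNorm W ≤ a i ∧
            C i = Matrix.reindex (finProdFinEquiv.trans (finCongr (hd i hi).symm))
              (Equiv.refl (Fin (d i))) (gamma (Smap i) W)))
  let f : (∀ i : ℕ, Matrix (Fin (d (i+1))) (Fin (d i)) ℝ) → Fin n → ℝ := fun C i =>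
    rampLoss η (netVec d C σ (x i) L) (y i)
  let T : Set (Fin n → ℝ) := {t | ∃ C, Ok C ∧ t = f C}
  let p : ℕ → ℝ := fun i => if i ∈ SA then (d (i+1) : ℝ) * d i else (c i : ℝ) * r i
  let κ : ℕ → ℝ := fun i => if i ∈ SA then 1 else Real.sqrt ((d (i+1) : ℝ) / (c i : ℝ))
  have hκ : ∀ i, 0 ≤ κ i := fun i => by simp only [κ]; split_ifs <;> positivity
  let b : ℕ → ℝ := fun i => 2 / η * P * X / s i
  have hb : ∀ i < L, 0 ≤ b i := fun i hi => by have := hs i hi; positivity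
  -- Lipschitz bound
  have hLip : ∀ C C', Ok C → Ok C' → auxL2 (f C - f C') ≤
      ∑ i ∈ Finset.range L, b i * specNorm (C i - C' i) := by
    intro C C' hC hC'
    set Q := ∑ i ∈ Finset.range L, specNorm (C i - C' i) / s i with hQ
    have hQ0 : 0 ≤ Q := Finset.sum_nonneg fun i hi =>
      div_nonneg (aux_spec_nonneg _) (hs i (Finset.mem_range.1 hi)).le
    have e : ∑ i ∈ Finset.range L, b i * specNorm (C i - C' i) = 2 / η * P * Q * X := by
      rw [hQ, Finset.mul_sum, Finset.sum_mul]
      refine Finset.sum_congr rfl fun i _ => ?_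
      simp only [b]; ring
    rw [e]
    refine abs_le_of_sq_le_sq' ?_ (by positivity) |>.2
    rw [auxL2_sq, mul_pow, hX, Real.sq_sqrt (by positivity), Finset.mul_sum]
    apply Finset.sum_le_sum
    intro i _
    have h1 := aux_loss_lip η hη (netVec d C σ (x i) L) (netVec d C' σ (x i) L) (y i)
    have h2 := (aux_net L d σ ρ s hρ hs hσ' hσ0 C C' hC.1 hC'.1 (x i) L le_rfl).2.2
    have h3 : |f C i - f C' i| ≤ 2 / η * P * Q * auxL2 (x i) := by
      refine h1.trans ?_
      calc _ ≤ 2 / η * (P * auxL2 (x i) * Q) := by gcongr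
        _ = _ := by ring
    rw [← auxL2_sq, ← mul_pow, Pi.sub_apply, ← sq_abs]
    gcongr
  -- the layer covers
  have hlayer : ∀ δ : ℝ, 0 < δ → ∀ i : ℕ, ∃ U : Finset (Matrix (Fin (d (i+1))) (Fin (d i)) ℝ),
      i < L → U.Nonempty ∧
      (∀ u ∈ U, specNorm u ≤ s i ∧ (i ∈ SA → frobNorm u ≤ a i) ∧
         (∀ (hi : i ∈ SW), ∃ W : Matrix (Fin (c i)) (Fin (r i)) ℝ, frobNorm W ≤ a i ∧
            u = Matrix.reindex (finProdFinEquiv.trans (finCongr (hd i hi).symm))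
              (Equiv.refl (Fin (d i))) (gamma (Smap i) W))) ∧
      Real.log U.card ≤ p i * Real.sqrt (2 * (a i * (κ i * b i)) / δ) ∧
      ∀ C, Ok C → ∃ u ∈ U, b i * specNorm (C i - u) ≤ δ := by
    intro δ hδ i
    by_cases hiA : i ∈ SA
    · have hiL := hSA i hiA
      obtain ⟨U, h1, h2, h3, h4⟩ := aux_layerA (d (i+1)) (d i) (s i) (a i) (b i) δ
        (hs i hiL).le (ha i hiL).le (hb i hiL) hδ
      refine ⟨U, fun _ => ⟨h1, fun u hu => ⟨(h2 u hu).1, fun _ => (h2 u hu).2, fun hi =>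
        absurd hi (Finset.disjoint_left.1 hdisj hiA)⟩, by simpa [p, κ, hiA] using h3, ?_⟩⟩
      intro C hC
      exact h4 (C i) (hC.1 i hiL) (hC.2.1 i hiA)
    · by_cases hiW : i ∈ SW
      · have hiL := hSW i hiW
        obtain ⟨U, h1, h2, h3, h4⟩ := aux_layerW (d (i+1)) (d i) (c i) (r i) (m i) (hd i hiW)
          (Smap i) (hSmap i hiW) (s i) (a i) (b i) δ
          (hs i hiL).le (ha i hiL).le (hb i hiL) hδ
        refine ⟨U, fun _ => ⟨h1, fun u hu => ⟨(h2 u hu).1, fun h => absurd h hiA, fun _ =>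
          (h2 u hu).2⟩, by simpa only [p, κ, hiA, if_false] using h3, ?_⟩⟩
        intro C hC
        exact h4 (C i) (hC.1 i hiL) (hC.2.2 i hiW)
      · refine ⟨∅, fun hiL => ?_⟩
        have : i ∈ SA ∪ SW := hpart ▸ Finset.mem_range.2 hiL
        rcases Finset.mem_union.1 this with h | h
        · exact absurd h hiA
        · exact absurd h hiW
  -- complexity identity
  set B := 2 * X *
        ((2 * P) *
          ((∑ i ∈ SA, (d (i+1) : ℝ) ^ 2 * (d i : ℝ) ^ 2 * a i / s i) +
           (∑ i ∈ SW,
             (c i : ℝ) ^ 2 * (r i : ℝ) ^ 2 * a i * Real.sqrt ((d (i+1) : ℝ) / (c i : ℝ)) / s i)) *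
          (L : ℝ) ^ 2) / η with hBdef
  have hB : B = ∑ i ∈ Finset.range L, (L : ℝ) ^ 2 * (p i ^ 2 * (2 * (a i * (κ i * b i)))) := by
    have e1 : ∑ i ∈ SA, (d (i+1) : ℝ) ^ 2 * (d i : ℝ) ^ 2 * a i / s i =
        ∑ i ∈ SA, p i ^ 2 * a i * κ i / s i := Finset.sum_congr rfl fun i hi => by
      simp only [p, κ, hi, if_true]; ring
    have e2 : ∑ i ∈ SW,
        (c i : ℝ) ^ 2 * (r i : ℝ) ^ 2 * a i * Real.sqrt ((d (i+1) : ℝ) / (c i : ℝ)) / s i =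
        ∑ i ∈ SW, p i ^ 2 * a i * κ i / s i := Finset.sum_congr rfl fun i hi => by
      have : i ∉ SA := Finset.disjoint_right.1 hdisj hi
      simp only [p, κ, this, if_false]; ring
    rw [hBdef, e1, e2, ← Finset.sum_union hdisj, hpart, Finset.mul_sum, Finset.sum_mul,
      Finset.mul_sum, Finset.sum_div]
    refine Finset.sum_congr rfl fun i _ => ?_
    simp only [b]; ring
  have hB0 : 0 ≤ B := by
    rw [hB]
    refine Finset.sum_nonneg fun i hi => ?_
    have h1 := ha i (Finset.mem_range.1 hi)
    have h2 := hb i (Finset.mem_range.1 hi)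
    have h3 := hκ i
    positivity
  have hcov : ∀ ε : ℝ, 0 < ε → ∃ U : Finset (Fin n → ℝ), U.Nonempty ∧ (∀ u ∈ U, u ∈ T) ∧
      Real.log U.card ≤ Real.sqrt (B / ε) ∧ ∀ t ∈ T, ∃ u ∈ U, auxL2 (t - u) ≤ ε := by
    intro ε hε
    have hδ : ∀ i, i < L → 0 < ε / L := fun i hi => by
      have : (0 : ℝ) < L := by exact_mod_cast (by omega : 0 < L)
      positivity
    have hl2 : ∀ i : ℕ, ∃ U : Finset (Matrix (Fin (d (i+1))) (Fin (d i)) ℝ),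
      i < L → U.Nonempty ∧
      (∀ u ∈ U, specNorm u ≤ s i ∧ (i ∈ SA → frobNorm u ≤ a i) ∧
         (∀ (hi : i ∈ SW), ∃ W : Matrix (Fin (c i)) (Fin (r i)) ℝ, frobNorm W ≤ a i ∧
            u = Matrix.reindex (finProdFinEquiv.trans (finCongr (hd i hi).symm))
              (Equiv.refl (Fin (d i))) (gamma (Smap i) W))) ∧
      Real.log U.card ≤ p i * Real.sqrt (2 * (a i * (κ i * b i)) / (ε / L)) ∧
      ∀ C, Ok C → ∃ u ∈ U, b i * specNorm (C i - u) ≤ ε / L := by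
      intro i
      by_cases hi : i < L
      · exact hlayer _ (hδ i hi) i
      · exact ⟨∅, fun h => absurd h hi⟩
    choose U hU using hl2
    let ext : (∀ i ∈ Finset.range L, Matrix (Fin (d (i+1))) (Fin (d i)) ℝ) →
        (∀ i : ℕ, Matrix (Fin (d (i+1))) (Fin (d i)) ℝ) :=
      fun g i => if h : i ∈ Finset.range L then g i h else 0
    have hext : ∀ g i (h : i ∈ Finset.range L), ext g i = g i h := fun g i h => by
      simp only [ext, h, dif_pos]
    have hextOk : ∀ g ∈ (Finset.range L).pi U, Ok (ext g) := by
      intro g hg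
      rw [Finset.mem_pi] at hg
      refine ⟨fun i hi => ?_, fun i hi => ?_, fun i hi => ?_⟩
      · have h := Finset.mem_range.2 hi
        rw [hext g i h]; exact ((hU i hi).2.1 _ (hg i h)).1
      · have h := Finset.mem_range.2 (hSA i hi)
        rw [hext g i h]; exact ((hU i (hSA i hi)).2.1 _ (hg i h)).2.1 hi
      · have h := Finset.mem_range.2 (hSW i hi)
        rw [hext g i h]; exact ((hU i (hSW i hi)).2.1 _ (hg i h)).2.2 hi
    have hne : ((Finset.range L).pi U).Nonempty := by
      rw [Finset.pi_nonempty]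
      exact fun i hi => (hU i (Finset.mem_range.1 hi)).1
    refine ⟨((Finset.range L).pi U).image (fun g => f (ext g)), hne.image _, ?_, ?_, ?_⟩
    · intro u hu
      obtain ⟨g, hg, rfl⟩ := Finset.mem_image.1 hu
      exact ⟨ext g, hextOk g hg, rfl⟩
    · have hpos : (0 : ℝ) < (((Finset.range L).pi U).image (fun g => f (ext g))).card := by
        exact_mod_cast Finset.card_pos.2 (hne.image _)
      have hle : ((((Finset.range L).pi U).image (fun g => f (ext g))).card : ℝ) ≤
          ((Finset.range L).pi U).card := by exact_mod_cast Finset.card_image_le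
      refine (Real.log_le_log hpos hle).trans ?_
      rw [Finset.card_pi, Nat.cast_prod, Real.log_prod (fun i hi => by
        have := Finset.card_pos.2 (hU i (Finset.mem_range.1 hi)).1
        positivity)]
      refine (Finset.sum_le_sum fun i hi => (hU i (Finset.mem_range.1 hi)).2.2.1).trans ?_
      rw [hB]
      refine aux_cs L p (fun i => 2 * (a i * (κ i * b i))) (fun i hi => ?_) ε hε
      have h1 := ha i hi
      have h2 := hb i hi
      have h3 := hκ i
      positivity
    · rintro _ ⟨C, hC, rfl⟩
      have hex : ∀ i (h : i ∈ Finset.range L), ∃ u ∈ U i, b i * specNorm (C i - u) ≤ ε / L :=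
        fun i h => (hU i (Finset.mem_range.1 h)).2.2.2 C hC
      choose g hg hg2 using hex
      have hgm : g ∈ (Finset.range L).pi U := Finset.mem_pi.2 hg
      refine ⟨f (ext g), Finset.mem_image.2 ⟨g, hgm, rfl⟩, ?_⟩
      refine (hLip C (ext g) hC (hextOk g hgm)).trans ?_
      have : ∑ i ∈ Finset.range L, b i * specNorm (C i - ext g i) ≤
          ∑ i ∈ Finset.range L, ε / L := Finset.sum_le_sum fun i hi => by
        rw [hext g i hi]; exact hg2 i hi
      refine this.trans ?_
      rw [Finset.sum_const, Finset.card_range, nsmul_eq_mul]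
      rcases Nat.eq_zero_or_pos L with h0 | h0
      · rw [h0]; simpa using hε.le
      · have : (0 : ℝ) < L := by exact_mod_cast h0
        apply le_of_eq; field_simp
  have hT : ∀ t ∈ T, auxL2 t ≤ Real.sqrt n := by
    rintro _ ⟨C, _, rfl⟩
    apply Real.sqrt_le_sqrt
    calc _ ≤ ∑ i : Fin n, (1 : ℝ) := Finset.sum_le_sum fun i _ => aux_loss_abs η hη _ _
      _ = n := by simp
  obtain ⟨U1, ⟨u1, hu1⟩, hU1T, _⟩ := hcov 1 one_pos
  obtain ⟨C1, hC1, _⟩ := hU1T u1 hu1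
  have hfin := aux_chain hn T B hB0 hT hcov
    (fun τ => (n : ℝ) * sSup { t : ℝ | ∃ C, Ok C ∧ t = (1 / n : ℝ) *
      ∑ i, (if τ i then (1 : ℝ) else -1) * rampLoss η (netVec d C σ (x i) L) (y i) }) (by
    intro τ z hz
    have : sSup { t : ℝ | ∃ C, Ok C ∧ t = (1 / n : ℝ) *
      ∑ i, (if τ i then (1 : ℝ) else -1) * rampLoss η (netVec d C σ (x i) L) (y i) } ≤ z / n := by
      apply csSup_le
      · exact ⟨_, C1, hC1, rfl⟩
      · rintro _ ⟨C, hC, rfl⟩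
        have := hz (f C) ⟨C, hC, rfl⟩
        rw [one_div, inv_mul_eq_div]
        exact div_le_div_of_nonneg_right this hN.le
    rw [le_div_iff₀ hN] at this
    linarith)
  rw [← Finset.mul_sum] at hfin
  have e8 : (n : ℝ) ^ (-(5 : ℝ) / 8) = (n : ℝ) ^ ((3 : ℝ) / 8) / n := by
    rw [← Real.rpow_sub_one hN.ne']; norm_num
  rw [e8, one_div, inv_mul_le_iff₀ (by positivity)]
  refine le_of_mul_le_mul_left (hfin.trans (le_of_eq ?_)) hN
  field_simp
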